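/- For any A ⊆ ℕ, the class of sets of the form {p : W^A_{g(p)} is an equivalence relation on its field with finitely many equivalence classes}, with g ranging over total A-recursive functions {0,1}* → {0,1}*, is exactly the class of Σ⁰₃(A) subsets of {0,1}*. -/

import Mathlib

/-- Codes for oracle partial recursive functions: `Nat.Partrec.Code` with an
extra constructor for one call to the oracle. -/
inductive OCode : Type
  | zero | succ | left | right | oracle
  | pair : OCode → OCode → OCode
  | comp : OCode → OCode → OCode
  | prec : OCode → OCode → OCode
  | rfind' : OCode → OCode

/-- Evaluation of an oracle code, relative to the oracle `O`. -/
def evalo (O : ℕ →. ℕ) : OCode → ℕ →. ℕ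
  | .zero => fun _ => Part.some 0
  | .succ => fun n => Part.some (n + 1)
  | .left => fun n => Part.some (Nat.unpair n).1
  | .right => fun n => Part.some (Nat.unpair n).2
  | .oracle => O
  | .pair cf cg => fun n => Nat.pair <$> evalo O cf n <*> evalo O cg n
  | .comp cf cg => fun n => evalo O cg n >>= evalo O cf
  | .prec cf cg => Nat.unpaired fun a n =>
      n.rec (evalo O cf a) fun y IH => do
        let i ← IH
        evalo O cg (Nat.pair a (Nat.pair y i))
  | .rfind' cf => Nat.unpaired fun a m =>
      (Nat.rfind fun n => (fun x => x = 0) <$> evalo O cf (Nat.pair a (n + m))).map (· + m)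

open Classical in
/-- The characteristic (total) partial function of a set of naturals. -/
noncomputable def chi (A : Set ℕ) : ℕ →. ℕ :=
  fun n => Part.some (if n ∈ A then 1 else 0)

/-- `f` is partial `A`-recursive (via encodings of `α` and `β`). -/
def RecInP {α β : Type*} [Primcodable α] [Primcodable β] (A : Set ℕ) (f : α →. β) : Prop :=
  ∃ c : OCode, ∀ a : α,
    evalo (chi A) c (Encodable.encode a) = (f a).map Encodable.encode

/-- An injective encoding of oracle codes into ℕ. -/
def encOCode : OCode → ℕ
  | .zero => 0
  | .succ => 1
  | .left => 2
  | .right => 3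
  | .oracle => 4
  | .pair a b => 4 * Nat.pair (encOCode a) (encOCode b) + 5
  | .comp a b => 4 * Nat.pair (encOCode a) (encOCode b) + 6
  | .prec a b => 4 * Nat.pair (encOCode a) (encOCode b) + 7
  | .rfind' a => 4 * encOCode a + 8

/-- The Turing jump A′ of A : the self-halting set relative to A. -/
def jump (A : Set ℕ) : Set ℕ :=
  {n | ∃ c : OCode, encOCode c = n ∧ (evalo (chi A) c n).Dom}

/-- The acceptable enumeration of A-r.e. subsets of ℕ: `W A e` is the domain of the
A-partial recursive function coded by `e`. -/
def W (A : Set ℕ) (e : ℕ) : Set ℕ :=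
  {n | ∃ c : OCode, encOCode c = e ∧ (evalo (chi A) c n).Dom}

/-- The acceptable enumeration of A-r.e. subsets of ℕ². -/
def W2 (A : Set ℕ) (e : ℕ) : Set (ℕ × ℕ) :=
  {x | ∃ c : OCode, encOCode c = e ∧ (evalo (chi A) c (Nat.pair x.1 x.2)).Dom}

/-- `E` is an equivalence relation on its field. -/
def IsEqvRel (E : Set (ℕ × ℕ)) : Prop :=
  (∀ x y, (x, y) ∈ E → (x, x) ∈ E ∧ (y, x) ∈ E) ∧
  (∀ x y z, (x, y) ∈ E → (y, z) ∈ E → (x, z) ∈ E)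

/-- The set of equivalence classes of `E`. -/
def eqvClasses (E : Set (ℕ × ℕ)) : Set (Set ℕ) :=
  {C | ∃ x, (x, x) ∈ E ∧ C = {y | (x, y) ∈ E}}

/-- `E` is an equivalence relation on its field with finitely many classes. -/
def FiniteIndexEqv (E : Set (ℕ × ℕ)) : Prop := IsEqvRel E ∧ (eqvClasses E).Finite

open Nat.Partrec (Code)

section Evaluation

theorem evalo_prec_zero (O : ℕ →. ℕ) (cf cg : OCode) (a : ℕ) :
    evalo O (.prec cf cg) (Nat.pair a 0) = evalo O cf a := by
  simp [evalo]

theorem evalo_prec_succ (O : ℕ →. ℕ) (cf cg : OCode) (a n : ℕ) :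
    evalo O (.prec cf cg) (Nat.pair a (n + 1)) =
      (evalo O (.prec cf cg) (Nat.pair a n)).bind fun i =>
        evalo O cg (Nat.pair a (Nat.pair n i)) := by
  simp [evalo]

theorem evalo_comp (O : ℕ →. ℕ) (cf cg : OCode) (n : ℕ) :
    evalo O (.comp cf cg) n = (evalo O cg n).bind fun a => evalo O cf a := rfl

theorem evalo_pair (O : ℕ →. ℕ) (cf cg : OCode) (n : ℕ) :
    evalo O (.pair cf cg) n =
      (evalo O cf n).bind fun a => (evalo O cg n).map fun b => Nat.pair a b := by
  simp [evalo, Seq.seq, Part.bind_map]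

theorem mem_evalo_rfind' {O : ℕ →. ℕ} {cf : OCode} {a m x : ℕ} :
    x ∈ evalo O (.rfind' cf) (Nat.pair a m) ↔
      ∃ n, n + m = x ∧ 0 ∈ evalo O cf (Nat.pair a (n + m)) ∧
        ∀ k < n, ∃ y, y ≠ 0 ∧ y ∈ evalo O cf (Nat.pair a (k + m)) := by
  simp only [evalo, Nat.unpaired, Nat.unpair_pair, Part.mem_map_iff, Part.map_eq_map]
  constructor
  · rintro ⟨n, hn, rfl⟩
    obtain ⟨h0, h⟩ := Nat.mem_rfind.1 hn
    obtain ⟨y, hy, hy0⟩ := (Part.mem_map_iff _).1 h0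
    obtain rfl : y = 0 := of_decide_eq_true hy0
    refine ⟨n, rfl, hy, fun k hk => ?_⟩
    obtain ⟨z, hz, hz0⟩ := (Part.mem_map_iff _).1 (h hk)
    exact ⟨z, of_decide_eq_false hz0, hz⟩
  · rintro ⟨n, rfl, h0, h⟩
    refine ⟨n, Nat.mem_rfind.2 ⟨(Part.mem_map_iff _).2 ⟨0, h0, by simp⟩, fun {k} hk => ?_⟩, rfl⟩
    obtain ⟨z, hz, hz'⟩ := h k hk
    exact (Part.mem_map_iff _).2 ⟨z, hz', by simpa using hz⟩

/-- Evaluation is monotone in the oracle. -/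
theorem evalo_mono {O O' : ℕ →. ℕ} (h : ∀ n, ∀ m ∈ O n, m ∈ O' n) (c : OCode) :
    ∀ n, ∀ m ∈ evalo O c n, m ∈ evalo O' c n := by
  induction c with
  | zero | succ | left | right => exact fun _ _ hm => hm
  | oracle => exact h
  | pair cf cg hf hg =>
    intro n m hm
    simp only [evalo_pair, Part.mem_bind_iff, Part.mem_map_iff] at hm ⊢
    obtain ⟨a, ha, b, hb, rfl⟩ := hm
    exact ⟨a, hf _ _ ha, b, hg _ _ hb, rfl⟩
  | comp cf cg hf hg =>
    intro n m hm
    simp only [evalo_comp, Part.mem_bind_iff] at hm ⊢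
    obtain ⟨a, ha, hm⟩ := hm
    exact ⟨a, hg _ _ ha, hf _ _ hm⟩
  | prec cf cg hf hg =>
    intro n
    rw [← Nat.pair_unpair n]
    induction n.unpair.2 with
    | zero => simpa only [evalo_prec_zero] using hf _
    | succ k ih =>
      intro m hm
      simp only [evalo_prec_succ, Part.mem_bind_iff] at hm ⊢
      obtain ⟨i, hi, hm⟩ := hm
      exact ⟨i, ih _ hi, hg _ _ hm⟩
  | rfind' cf hf =>
    intro n m
    rw [← Nat.pair_unpair n, mem_evalo_rfind', mem_evalo_rfind']
    rintro ⟨k, hk, h0, hlt⟩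
    refine ⟨k, hk, hf _ _ h0, fun j hj => ?_⟩
    obtain ⟨y, hy, hy'⟩ := hlt j hj
    exact ⟨y, hy, hf _ _ hy'⟩

/-- The use principle: a halting computation relative to the union of an increasing chain of
partial oracles already halts relative to some member of the chain. -/
theorem exists_mem_evalo_of_chain {O : ℕ →. ℕ} {P : ℕ → ℕ →. ℕ}
    (hP : ∀ i j, i ≤ j → ∀ n, ∀ m ∈ P i n, m ∈ P j n)
    (hO : ∀ n, ∀ m ∈ O n, ∃ i, m ∈ P i n) (c : OCode) :
    ∀ n, ∀ m ∈ evalo O c n, ∃ i, m ∈ evalo (P i) c n := by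
  have up {i j c n m} (hij : i ≤ j) (hm : m ∈ evalo (P i) c n) : m ∈ evalo (P j) c n :=
    evalo_mono (hP i j hij) c n m hm
  induction c with
  | zero | succ | left | right => exact fun _ _ hm => ⟨0, hm⟩
  | oracle => exact hO
  | pair cf cg hf hg =>
    intro n m hm
    simp only [evalo_pair, Part.mem_bind_iff, Part.mem_map_iff] at hm ⊢
    obtain ⟨a, ha, b, hb, rfl⟩ := hm
    obtain ⟨i, hi⟩ := hf _ _ ha
    obtain ⟨j, hj⟩ := hg _ _ hb
    exact ⟨max i j, a, up (le_max_left _ _) hi, b, up (le_max_right _ _) hj, rfl⟩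
  | comp cf cg hf hg =>
    intro n m hm
    simp only [evalo_comp, Part.mem_bind_iff] at hm ⊢
    obtain ⟨a, ha, hm⟩ := hm
    obtain ⟨i, hi⟩ := hg _ _ ha
    obtain ⟨j, hj⟩ := hf _ _ hm
    exact ⟨max i j, a, up (le_max_left _ _) hi, up (le_max_right _ _) hj⟩
  | prec cf cg hf hg =>
    intro n
    rw [← Nat.pair_unpair n]
    induction n.unpair.2 with
    | zero => simpa only [evalo_prec_zero] using hf _
    | succ k ih =>
      intro m hm
      simp only [evalo_prec_succ, Part.mem_bind_iff] at hm ⊢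
      obtain ⟨a, ha, hm⟩ := hm
      obtain ⟨i, hi⟩ := ih _ ha
      obtain ⟨j, hj⟩ := hg _ _ hm
      exact ⟨max i j, a, up (le_max_left _ _) hi, up (le_max_right _ _) hj⟩
  | rfind' cf hf =>
    intro n m
    rw [← Nat.pair_unpair n]
    simp only [mem_evalo_rfind']
    rintro ⟨k, hk, h0, hlt⟩
    choose! y hy hy' using hlt
    obtain ⟨i, hi⟩ := hf _ _ h0
    choose! j hj using fun l hl => hf _ _ (hy' l hl)
    refine ⟨max i ((Finset.range k).sup j), k, hk, up (le_max_left _ _) hi, fun l hl =>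
      ⟨y l, hy l hl, up (le_max_of_le_right ?_) (hj l hl)⟩⟩
    exact Finset.le_sup (f := j) (Finset.mem_range.2 hl)

end Evaluation

section Translation

/-- An ordinary code, read as an oracle code that never consults its oracle. -/
def OCode.ofCode : Code → OCode
  | .zero => .zero
  | .succ => .succ
  | .left => .left
  | .right => .right
  | .pair cf cg => .pair (ofCode cf) (ofCode cg)
  | .comp cf cg => .comp (ofCode cf) (ofCode cg)
  | .prec cf cg => .prec (ofCode cf) (ofCode cg)
  | .rfind' cf => .rfind' (ofCode cf)

theorem evalo_ofCode (O : ℕ →. ℕ) (c : Code) : evalo O (.ofCode c) = c.eval := by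
  induction c with
  | zero | succ | left | right => rfl
  | pair cf cg hf hg | comp cf cg hf hg | prec cf cg hf hg =>
    simp only [OCode.ofCode, evalo, Code.eval, hf, hg]; rfl
  | rfind' cf hf => simp only [OCode.ofCode, evalo, Code.eval, hf]; rfl

namespace Nat.Partrec.Code

theorem eval_comp (cf cg : Code) (n : ℕ) :
    eval (comp cf cg) n = (eval cg n).bind fun a => eval cf a := rfl

theorem eval_pair (cf cg : Code) (n : ℕ) :
    eval (pair cf cg) n =
      (eval cf n).bind fun a => (eval cg n).map fun b => Nat.pair a b := by
  simp [eval, Seq.seq, Part.bind_map]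

theorem eval_left (n : ℕ) : eval left n = Part.some n.unpair.1 := rfl

theorem eval_right (n : ℕ) : eval right n = Part.some n.unpair.2 := rfl

theorem eval_succ (n : ℕ) : eval succ n = Part.some (n + 1) := rfl

/-- Code for the reassociation `⟨⟨s, a⟩, b⟩ ↦ ⟨s, ⟨a, b⟩⟩`. -/
def assoc : Code :=
  pair (comp left left) (pair (comp right left) right)

/-- Code for the reassociation `⟨s, ⟨a, b⟩⟩ ↦ ⟨⟨s, a⟩, b⟩`. -/
def assocInv : Code :=
  pair (pair left (comp left right)) (comp right right)

theorem eval_assoc (s a b : ℕ) :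
    eval assoc (Nat.pair (Nat.pair s a) b) = Part.some (Nat.pair s (Nat.pair a b)) := by
  simp [assoc, eval_comp, eval_pair, eval_left, eval_right]

theorem eval_assocInv (s a b : ℕ) :
    eval assocInv (Nat.pair s (Nat.pair a b)) = Part.some (Nat.pair (Nat.pair s a) b) := by
  simp [assocInv, eval_comp, eval_pair, eval_left, eval_right]

/-- Translate an oracle code to a code taking an extra parameter `s`, in which the oracle is
simulated by the code `L`. -/
def ofOCode (L : Code) : OCode → Code
  | .zero => zero
  | .succ => comp succ right
  | .left => comp left right
  | .right => comp right right
  | .oracle => L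
  | .pair cf cg => pair (ofOCode L cf) (ofOCode L cg)
  | .comp cf cg => comp (ofOCode L cf) (pair left (ofOCode L cg))
  | .prec cf cg => comp (prec (ofOCode L cf) (comp (ofOCode L cg) assoc)) assocInv
  | .rfind' cf => comp (rfind' (comp (ofOCode L cf) assoc)) assocInv

theorem eval_ofOCode {L : Code} {O : ℕ →. ℕ} {s : ℕ}
    (h : ∀ n, eval L (Nat.pair s n) = O n) (c : OCode) :
    ∀ n, eval (ofOCode L c) (Nat.pair s n) = evalo O c n := by
  induction c with
  | zero => intro n; rfl
  | succ | left | right =>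
    intro n
    simp [ofOCode, eval_comp, eval_left, eval_right, eval_succ, evalo]
  | oracle => exact h
  | pair cf cg hf hg => intro n; simp only [ofOCode, eval_pair, evalo_pair, hf, hg]
  | comp cf cg hf hg =>
    intro n
    simp [ofOCode, eval_comp, eval_pair, eval_left, hg, evalo_comp, Part.bind_map, hf]
  | prec cf cg hf hg =>
    intro n
    obtain ⟨a, k, rfl⟩ : ∃ a k, n = Nat.pair a k := ⟨_, _, (Nat.pair_unpair n).symm⟩
    have : eval (ofOCode L (.prec cf cg)) (Nat.pair s (Nat.pair a k)) =
        eval (prec (ofOCode L cf) (comp (ofOCode L cg) assoc)) (Nat.pair (Nat.pair s a) k) := by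
      rw [ofOCode, eval_comp, eval_assocInv, Part.bind_some]
    rw [this]
    clear this
    induction k with
    | zero => rw [eval_prec_zero, evalo_prec_zero, hf]
    | succ k ih =>
      rw [eval_prec_succ, evalo_prec_succ, ih]
      refine congrArg (Part.bind _) (funext fun i => ?_)
      rw [eval_comp, eval_assoc, Part.bind_some, hg]
  | rfind' cf hf =>
    intro n
    obtain ⟨a, k, rfl⟩ : ∃ a k, n = Nat.pair a k := ⟨_, _, (Nat.pair_unpair n).symm⟩
    have (m : ℕ) : eval (comp (ofOCode L cf) assoc) (Nat.pair (Nat.pair s a) m) =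
        evalo O cf (Nat.pair a m) := by
      rw [eval_comp, eval_assoc, Part.bind_some, hf]
    rw [ofOCode, eval_comp, eval_assocInv, Part.bind_some]
    simp only [eval, evalo, Nat.unpaired, Nat.unpair_pair] at this ⊢
    simp only [this]

/-- The translation `ofOCode` on the level of indices. -/
def ofOIndex (L : Code) : ℕ → Code
  | 0 => zero
  | 1 => comp succ right
  | 2 => comp left right
  | 3 => comp right right
  | 4 => L
  | n + 5 =>
    have h : n / 4 < n + 5 := by omega
    have h₁ : (n / 4).unpair.1 < n + 5 := (Nat.unpair_left_le _).trans_lt h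
    have h₂ : (n / 4).unpair.2 < n + 5 := (Nat.unpair_right_le _).trans_lt h
    if n % 4 = 0 then pair (ofOIndex L (n / 4).unpair.1) (ofOIndex L (n / 4).unpair.2)
    else if n % 4 = 1 then
      comp (ofOIndex L (n / 4).unpair.1) (pair left (ofOIndex L (n / 4).unpair.2))
    else if n % 4 = 2 then
      comp (prec (ofOIndex L (n / 4).unpair.1) (comp (ofOIndex L (n / 4).unpair.2) assoc))
        assocInv
    else comp (rfind' (comp (ofOIndex L (n / 4)) assoc)) assocInv

theorem ofOIndex_encOCode (L : Code) (c : OCode) : ofOIndex L (encOCode c) = ofOCode L c := by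
  induction c with
  | zero | succ | left | right | oracle => simp [encOCode, ofOCode, ofOIndex]
  | pair a b ha hb =>
    rw [encOCode, ofOIndex]
    simp [ofOCode, ha, hb]
  | comp a b ha hb =>
    rw [encOCode, ofOIndex, Nat.mul_add_mod, Nat.mul_add_div (by simp)]
    simp [ofOCode, ha, hb]
  | prec a b ha hb =>
    rw [encOCode, ofOIndex, Nat.mul_add_mod, Nat.mul_add_div (by simp)]
    simp [ofOCode, ha, hb]
  | rfind' a ha =>
    rw [encOCode, ofOIndex, Nat.mul_add_mod, Nat.mul_add_div (by simp)]
    simp [ofOCode, ha]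

theorem primrec_ofOIndex (L : Code) : Primrec (ofOIndex L) := by
  let lk (l : List Code) (i : ℕ) : Code := l.getD i zero
  let k (l : List Code) : ℕ := (l.length - 5) / 4
  let step (l : List Code) : Code :=
    if l.length = 0 then zero
    else if l.length = 1 then comp succ right
    else if l.length = 2 then comp left right
    else if l.length = 3 then comp right right
    else if l.length = 4 then L
    else if (l.length - 5) % 4 = 0 then pair (lk l (k l).unpair.1) (lk l (k l).unpair.2)
    else if (l.length - 5) % 4 = 1 then
      comp (lk l (k l).unpair.1) (pair left (lk l (k l).unpair.2))
    else if (l.length - 5) % 4 = 2 then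
      comp (prec (lk l (k l).unpair.1) (comp (lk l (k l).unpair.2) assoc)) assocInv
    else comp (rfind' (comp (lk l (k l)) assoc)) assocInv
  have hlen : Primrec (List.length : List Code → ℕ) := Primrec.list_length
  have hsub : Primrec fun l : List Code => l.length - 5 :=
    Primrec.nat_sub.comp hlen (_root_.Primrec.const 5)
  have hk : Primrec k := Primrec.nat_div.comp hsub (_root_.Primrec.const 4)
  have hlk {f : List Code → ℕ} (hf : Primrec f) : Primrec fun l => lk l (f l) :=
    (Primrec.list_getD zero).comp _root_.Primrec.id hf
  have h₁ := hlk (Primrec.fst.comp (Primrec.unpair.comp hk))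
  have h₂ := hlk (Primrec.snd.comp (Primrec.unpair.comp hk))
  have heq {f : List Code → ℕ} (hf : Primrec f) (c : ℕ) : PrimrecPred fun l => f l = c :=
    Primrec.eq.comp hf (_root_.Primrec.const c)
  have hmod : Primrec fun l : List Code => (l.length - 5) % 4 :=
    Primrec.nat_mod.comp hsub (_root_.Primrec.const 4)
  have hstep : Primrec step := by
    refine Primrec.ite (heq hlen 0) (_root_.Primrec.const _) <|
      Primrec.ite (heq hlen 1) (_root_.Primrec.const _) <|
      Primrec.ite (heq hlen 2) (_root_.Primrec.const _) <|
      Primrec.ite (heq hlen 3) (_root_.Primrec.const _) <|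
      Primrec.ite (heq hlen 4) (_root_.Primrec.const _) <|
      Primrec.ite (heq hmod 0) (primrec₂_pair.comp h₁ h₂) <|
      Primrec.ite (heq hmod 1)
        (primrec₂_comp.comp h₁ (primrec₂_pair.comp (_root_.Primrec.const _) h₂)) <|
      Primrec.ite (heq hmod 2)
        (primrec₂_comp.comp (primrec₂_prec.comp h₁ (primrec₂_comp.comp h₂ (_root_.Primrec.const _)))
          (_root_.Primrec.const _))
        (primrec₂_comp.comp
          (primrec_rfind'.comp (primrec₂_comp.comp (hlk hk) (_root_.Primrec.const _)))
          (_root_.Primrec.const _))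
  have key : Primrec₂ fun (_ : Unit) n => ofOIndex L n := by
    refine Primrec.nat_strong_rec _ (g := fun _ l => some (step l))
      (Primrec.option_some.comp (hstep.comp Primrec.snd)).to₂ fun _ n => ?_
    refine congrArg some ?_
    match n with
    | 0 | 1 | 2 | 3 | 4 => simp [step, ofOIndex]
    | n + 5 =>
      have h : n / 4 < n + 5 := by omega
      have h₁ : (n / 4).unpair.1 < n + 5 := (Nat.unpair_left_le _).trans_lt h
      have h₂ : (n / 4).unpair.2 < n + 5 := (Nat.unpair_right_le _).trans_lt h
      rw [ofOIndex]
      simp [step, lk, k, h, h₁, h₂]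
  exact key.comp (_root_.Primrec.const ()) _root_.Primrec.id

/-- There is a code for list lookup. -/
theorem exists_eval_eq_getElem? :
    ∃ L : Code, ∀ (l : List ℕ) (n : ℕ),
      eval L (Nat.pair (Encodable.encode l) n) = ((l[n]? : Option ℕ) : Part ℕ) := by
  have h : Partrec fun p : List ℕ × ℕ => ((p.1[p.2]? : Option ℕ) : Part ℕ) :=
    Computable.ofOption (Primrec.list_getElem?.to_comp)
  obtain ⟨L, hL⟩ := exists_code.1 h
  refine ⟨L, fun l n => ?_⟩
  have := congrFun hL (Encodable.encode (l, n))
  simp only [Encodable.encodek] at this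
  simpa [Part.map_id'] using this

end Nat.Partrec.Code

theorem exists_encOCode_eq (n : ℕ) : ∃ c, encOCode c = n := by
  induction n using Nat.strong_induction_on with
  | _ n ih =>
    match n with
    | 0 => exact ⟨.zero, rfl⟩
    | 1 => exact ⟨.succ, rfl⟩
    | 2 => exact ⟨.left, rfl⟩
    | 3 => exact ⟨.right, rfl⟩
    | 4 => exact ⟨.oracle, rfl⟩
    | n + 5 =>
      have h : n / 4 < n + 5 := by omega
      obtain ⟨a, ha⟩ := ih _ ((Nat.unpair_left_le _).trans_lt h)
      obtain ⟨b, hb⟩ := ih _ ((Nat.unpair_right_le _).trans_lt h)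
      obtain ⟨c, hc⟩ := ih _ h
      have hab : Nat.pair (encOCode a) (encOCode b) = n / 4 := by rw [ha, hb, Nat.pair_unpair]
      have : n % 4 = 0 ∨ n % 4 = 1 ∨ n % 4 = 2 ∨ n % 4 = 3 := by omega
      rcases this with h | h | h | h
      · exact ⟨.pair a b, by rw [encOCode, hab]; omega⟩
      · exact ⟨.comp a b, by rw [encOCode, hab]; omega⟩
      · exact ⟨.prec a b, by rw [encOCode, hab]; omega⟩
      · exact ⟨.rfind' c, by rw [encOCode, hc]; omega⟩

end Translation

section Relative

open Encodable

variable {α β γ σ : Type*} [Primcodable α] [Primcodable β] [Primcodable γ] [Primcodable σ]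
variable {A : Set ℕ}

/-- The total function `f` is `A`-recursive. -/
def TotRec (A : Set ℕ) (f : α → β) : Prop := RecInP A fun a => Part.some (f a)

theorem totRec_iff {f : α → β} :
    TotRec A f ↔ ∃ c, ∀ a, evalo (chi A) c (encode a) = Part.some (encode (f a)) := by
  simp [TotRec, RecInP]

namespace TotRec

theorem of_computable {f : α → β} (hf : Computable f) : TotRec A f := by
  obtain ⟨c, hc⟩ := Code.exists_code.1 hf
  refine totRec_iff.2 ⟨.ofCode c, fun a => ?_⟩
  rw [evalo_ofCode, hc]
  simp

theorem of_primrec {f : α → β} (hf : Primrec f) : TotRec A f := of_computable hf.to_comp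

theorem comp {f : β → γ} {g : α → β} (hf : TotRec A f) (hg : TotRec A g) :
    TotRec A fun a => f (g a) := by
  obtain ⟨cf, hf⟩ := totRec_iff.1 hf
  obtain ⟨cg, hg⟩ := totRec_iff.1 hg
  exact totRec_iff.2 ⟨.comp cf cg, fun a => by rw [evalo_comp, hg, Part.bind_some, hf]⟩

theorem pair {f : α → β} {g : α → γ} (hf : TotRec A f) (hg : TotRec A g) :
    TotRec A fun a => (f a, g a) := by
  obtain ⟨cf, hf⟩ := totRec_iff.1 hf
  obtain ⟨cg, hg⟩ := totRec_iff.1 hg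
  refine totRec_iff.2 ⟨.pair cf cg, fun a => ?_⟩
  rw [evalo_pair, hf, hg, Part.bind_some, Part.map_some, encode_prod_val]

theorem fst : TotRec A (Prod.fst : α × β → α) := of_primrec .fst

theorem snd : TotRec A (Prod.snd : α × β → β) := of_primrec .snd

theorem const (b : β) : TotRec A fun _ : α => b := of_primrec (.const b)

theorem comp₂ {f : β → γ → σ} {g : α → β} {h : α → γ} (hf : Primrec₂ f)
    (hg : TotRec A g) (hh : TotRec A h) : TotRec A fun a => f (g a) (h a) :=
  (of_primrec (f := fun p : β × γ => f p.1 p.2) hf).comp (hg.pair hh)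

theorem nat_rec {f : α → β} {g : α × ℕ × β → β} (hf : TotRec A f) (hg : TotRec A g) :
    TotRec A fun p : α × ℕ => (Nat.rec (f p.1) (fun y ih => g (p.1, y, ih)) p.2 : β) := by
  obtain ⟨cf, hf⟩ := totRec_iff.1 hf
  obtain ⟨cg, hg⟩ := totRec_iff.1 hg
  refine totRec_iff.2 ⟨.prec cf cg, fun ⟨a, n⟩ => ?_⟩
  rw [encode_prod_val, encode_nat]
  induction n with
  | zero => exact (evalo_prec_zero ..).trans (hf a)
  | succ n ih =>
    rw [evalo_prec_succ, ih, Part.bind_some]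
    exact hg (a, n, _)

end TotRec

open Classical in
/-- The predicate `P` is `A`-recursive. -/
def RecPred (A : Set ℕ) (P : α → Prop) : Prop := TotRec A fun a => if P a then 1 else 0

namespace RecPred

theorem of_eq_const [DecidableEq β] {f : α → β} (hf : TotRec A f) (b : β) :
    RecPred A fun a => f a = b := by
  have : Primrec fun x : β => if x = b then 1 else 0 :=
    .ite (Primrec.eq.comp .id (.const b)) (.const 1) (.const 0)
  unfold RecPred
  convert (TotRec.of_primrec this).comp hf

theorem of_primrecPred {P : α → Prop} (hP : PrimrecPred P) : RecPred A P := by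
  classical
  have : Primrec fun x : α => if P x then 1 else 0 := .ite hP (.const 1) (.const 0)
  unfold RecPred
  convert TotRec.of_primrec this

theorem comp {P : β → Prop} {f : α → β} (hP : RecPred A P) (hf : TotRec A f) :
    RecPred A fun a => P (f a) :=
  TotRec.comp hP hf

theorem of_rel {R : β → γ → Prop} {f : α → β} {g : α → γ} (hR : PrimrecRel R)
    (hf : TotRec A f) (hg : TotRec A g) : RecPred A fun a => R (f a) (g a) :=
  (of_primrecPred (P := fun p : β × γ => R p.1 p.2) hR).comp (hf.pair hg)

theorem not {P : α → Prop} (hP : RecPred A P) : RecPred A fun a => ¬ P a := by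
  classical
  refine (congrArg (TotRec A) (funext fun a => ?_)).mp
    (TotRec.comp₂ Primrec.nat_sub (TotRec.const 1) hP)
  by_cases h : P a <;> simp [h]

theorem and {P Q : α → Prop} (hP : RecPred A P) (hQ : RecPred A Q) :
    RecPred A fun a => P a ∧ Q a := by
  classical
  refine (congrArg (TotRec A) (funext fun a => ?_)).mp (TotRec.comp₂ Primrec.nat_mul hP hQ)
  by_cases h : P a <;> simp [h]

theorem of_iff {P Q : α → Prop} (hP : RecPred A P) (h : ∀ a, P a ↔ Q a) : RecPred A Q :=
  (funext fun a => propext (h a) : P = Q) ▸ hP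

theorem or {P Q : α → Prop} (hP : RecPred A P) (hQ : RecPred A Q) :
    RecPred A fun a => P a ∨ Q a :=
  (hP.not.and hQ.not).not.of_iff fun _ => by tauto

theorem imp {P Q : α → Prop} (hP : RecPred A P) (hQ : RecPred A Q) :
    RecPred A fun a => P a → Q a :=
  (hP.not.or hQ).of_iff fun _ => by tauto

theorem forall_lt {P : α × ℕ → Prop} (hP : RecPred A P) :
    RecPred A fun p : α × ℕ => ∀ v < p.2, P (p.1, v) := by
  classical
  have hg : TotRec A fun z : α × ℕ × ℕ => (if P (z.1, z.2.1) then 1 else 0) * z.2.2 :=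
    TotRec.comp₂ Primrec.nat_mul
      (hP.comp (TotRec.fst.pair (TotRec.fst.comp TotRec.snd))) (TotRec.snd.comp TotRec.snd)
  refine (congrArg (TotRec A) (funext fun p => ?_)).mp ((TotRec.const 1).nat_rec hg)
  obtain ⟨a, n⟩ := p
  dsimp only
  induction n with
  | zero => simp
  | succ n ih =>
    simp only [ih, Nat.lt_succ_iff_lt_or_eq, or_imp, forall_and, forall_eq]
    split_ifs <;> simp_all

/-- An existential quantifier in front of an `A`-recursive predicate can be realized as the
halting of an unbounded search. -/
theorem exists_code_dom_iff {σ : Type*} [Denumerable σ] {Q : α × σ → Prop} (hQ : RecPred A Q) :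
    ∃ c, ∀ a, (evalo (chi A) c (encode a)).Dom ↔ ∃ s, Q (a, s) := by
  classical
  have hq : TotRec A fun p : α × ℕ => if ¬ Q (p.1, Denumerable.ofNat σ p.2) then 1 else 0 := by
    convert TotRec.comp hQ.not
      (TotRec.fst.pair ((TotRec.of_primrec (Primrec.ofNat σ)).comp TotRec.snd))
  obtain ⟨cq, hcq⟩ := totRec_iff.1 hq
  obtain ⟨ci, hci⟩ := totRec_iff.1 (TotRec.of_primrec (A := A)
    (_root_.Primrec.pair .id (.const 0) : Primrec fun a : α => (a, 0)))
  have hval (a : α) (n : ℕ) : evalo (chi A) cq (Nat.pair (encode a) n) =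
      Part.some (if ¬ Q (a, Denumerable.ofNat σ n) then 1 else 0) := hcq (a, n)
  refine ⟨.comp (.rfind' cq) ci, fun a => ?_⟩
  rw [evalo_comp, hci, Part.bind_some, encode_prod_val, Part.dom_iff_mem]
  simp only [encode_nat, mem_evalo_rfind', add_zero, hval, Part.mem_some_iff]
  constructor
  · rintro ⟨_, n, -, h, -⟩
    exact ⟨_, by simpa using h⟩
  · rintro ⟨s, hs⟩
    have hex : ∃ n, Q (a, Denumerable.ofNat σ n) := ⟨encode s, by simpa using hs⟩
    refine ⟨_, Nat.find hex, rfl, by simpa using Nat.find_spec hex, fun k hk => ?_⟩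
    exact ⟨1, one_ne_zero, by simp [Nat.find_min hex hk]⟩

end RecPred

open Classical in
/-- The initial segment of length `k` of the characteristic function of `A`. -/
noncomputable def initSeg (A : Set ℕ) (k : ℕ) : List ℕ :=
  (List.range k).map fun i => if i ∈ A then 1 else 0

theorem totRec_initSeg : TotRec A (initSeg A) := by
  classical
  have hchi : TotRec A fun n : ℕ => if n ∈ A then 1 else 0 := by
    refine totRec_iff.2 ⟨.oracle, fun n => ?_⟩
    simp only [evalo, chi, encode_nat]
  have hg : TotRec A fun z : Unit × ℕ × List ℕ => z.2.2 ++ [if z.2.1 ∈ A then 1 else 0] :=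
    TotRec.comp₂ (f := fun (l : List ℕ) (a : ℕ) => l ++ [a]) Primrec.list_concat
      (TotRec.snd.comp TotRec.snd) (hchi.comp (TotRec.fst.comp TotRec.snd))
  refine (congrArg (TotRec A) (funext fun k => ?_)).mp
    (((TotRec.const []).nat_rec hg).comp ((TotRec.const ()).pair (TotRec.of_primrec .id)))
  induction k with
  | zero => rfl
  | succ k ih =>
    simp only [id, initSeg, List.range_succ, List.map_append] at ih ⊢
    simp [ih]

/-- Halting relative to `A` is uniformly recursively enumerable relative to `A`. -/
theorem exists_recPred_dom_iff (A : Set ℕ) :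
    ∃ D : ℕ × ℕ × ℕ → Prop, RecPred A D ∧
      ∀ c x, (evalo (chi A) c x).Dom ↔ ∃ t, D (encOCode c, x, t) := by
  obtain ⟨L, hL⟩ := Code.exists_eval_eq_getElem?
  let D : ℕ × ℕ × ℕ → Prop := fun z =>
    (Code.evaln z.2.2.unpair.2 (Code.ofOIndex L z.1)
      (Nat.pair (encode (initSeg A z.2.2.unpair.1)) z.2.1)).isSome = true
  have h₁ : TotRec A fun z : ℕ × ℕ × ℕ => z.2.2.unpair :=
    (TotRec.of_primrec Primrec.unpair).comp (TotRec.snd.comp TotRec.snd)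
  have hD : RecPred A D := by
    refine RecPred.of_eq_const ?_ true
    refine (TotRec.of_primrec (Primrec.option_isSome.comp Code.primrec_evaln)).comp
      (((TotRec.snd.comp h₁).pair
        ((TotRec.of_primrec (Code.primrec_ofOIndex L)).comp TotRec.fst)).pair
        (TotRec.comp₂ Primrec₂.natPair ?_ (TotRec.fst.comp TotRec.snd)))
    exact ((TotRec.of_primrec Primrec.encode).comp totRec_initSeg).comp (TotRec.fst.comp h₁)
  let P (k : ℕ) : ℕ →. ℕ := fun n => ((initSeg A k)[n]? : Option ℕ)
  have hP (k n m : ℕ) : m ∈ P k n ↔ n < k ∧ m ∈ chi A n := by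
    simp only [P, initSeg, chi, Part.mem_ofOption, Part.mem_some_iff, List.getElem?_map]
    by_cases h : n < k
    · simp [h, eq_comm (a := m)]
    · simp [h]
  refine ⟨D, hD, fun c x => ?_⟩
  have hev (k : ℕ) := Code.eval_ofOCode (O := P k) (hL (initSeg A k)) c x
  simp only [D, Code.ofOIndex_encOCode, Option.isSome_iff_exists, Part.dom_iff_mem]
  constructor
  · rintro ⟨m, hm⟩
    obtain ⟨k, hk⟩ := exists_mem_evalo_of_chain (P := P)
      (fun i j hij n m h => (hP j n m).2 ⟨((hP i n m).1 h).1.trans_le hij, ((hP i n m).1 h).2⟩)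
      (fun n m h => ⟨n + 1, (hP _ n m).2 ⟨n.lt_succ_self, h⟩⟩) c x m hm
    rw [← hev] at hk
    obtain ⟨s, hs⟩ := Code.evaln_complete.1 hk
    exact ⟨Nat.pair k s, m, by simpa using hs⟩
  · rintro ⟨t, m, hm⟩
    have := Code.evaln_sound hm
    rw [hev] at this
    exact ⟨m, evalo_mono (fun n m h => ((hP _ n m).1 h).2) c x m this⟩

theorem mem_W2_encOCode {c : OCode} {x y : ℕ} :
    (x, y) ∈ W2 A (encOCode c) ↔ (evalo (chi A) c (Nat.pair x y)).Dom := by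
  obtain ⟨D, -, hD⟩ := exists_recPred_dom_iff A
  constructor
  · rintro ⟨c', hc', h⟩
    rw [hD, hc', ← hD] at h
    exact h
  · exact fun h => ⟨c, rfl, h⟩

theorem primrec_encOCode_const : Primrec fun n => encOCode (.ofCode (Code.const n)) := by
  have : Primrec fun n : ℕ =>
      (Nat.rec 0 (fun _ ih => 4 * Nat.pair 1 ih + 6) n : ℕ) :=
    Primrec.nat_rec' .id (.const 0) <| Primrec.to₂ <|
      Primrec.nat_add.comp (Primrec.nat_mul.comp (.const 4)
        (Primrec₂.natPair.comp (.const 1) (Primrec.snd.comp .snd))) (.const 6)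
  refine this.of_eq fun n => ?_
  induction n with
  | zero => rfl
  | succ n ih => simp only [ih, Code.const, OCode.ofCode, encOCode]

/-- The s-m-n theorem for oracle codes. -/
theorem exists_primrec_curry (O : ℕ →. ℕ) (c : OCode) :
    ∃ h : ℕ → ℕ, Primrec h ∧ ∀ a, ∃ c', encOCode c' = h a ∧
      ∀ n, evalo O c' n = evalo O c (Nat.pair a n) := by
  refine ⟨fun a => encOCode (.comp c (.pair (.ofCode (.const a)) (.pair .left .right))), ?_,
    fun a => ⟨_, rfl, fun n => ?_⟩⟩
  · simp only [encOCode]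
    exact Primrec.nat_add.comp (Primrec.nat_mul.comp (.const 4) (Primrec₂.natPair.comp (.const _)
      (Primrec.nat_add.comp (Primrec.nat_mul.comp (.const 4)
        (Primrec₂.natPair.comp primrec_encOCode_const (.const _))) (.const 5)))) (.const 6)
  · rw [evalo_comp, evalo_pair, evalo_pair, evalo_ofCode, Code.eval_const]
    simp [evalo]

end Relative

section EquivalenceRelations

theorem finiteIndexEqv_iff {E : Set (ℕ × ℕ)} :
    FiniteIndexEqv E ↔
      IsEqvRel E ∧ ∃ N, ∀ x, (x, x) ∈ E → ∃ y < N, (x, y) ∈ E := by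
  refine and_congr_right fun hE => ⟨fun hfin => ?_, fun ⟨N, hN⟩ => ?_⟩
  · obtain ⟨N, hN⟩ := (hfin.image sInf).bddAbove
    refine ⟨N + 1, fun x hx => ⟨sInf {y | (x, y) ∈ E}, ?_, ?_⟩⟩
    · exact Nat.lt_succ_of_le (hN ⟨_, ⟨x, hx, rfl⟩, rfl⟩)
    · exact Nat.sInf_mem (s := {y | (x, y) ∈ E}) ⟨x, hx⟩
  · refine ((Set.finite_Iio N).image fun y => {z | (y, z) ∈ E}).subset ?_
    rintro _ ⟨x, hx, rfl⟩
    obtain ⟨y, hy, hxy⟩ := hN x hx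
    refine ⟨y, hy, Set.ext fun z => ⟨hE.2 _ _ _ hxy, hE.2 _ _ _ (hE.1 _ _ hxy).2⟩⟩

/-- The relation that, for each column `u`, has an element `⟨u, k⟩` whenever `T u k` holds, all
those with `T u (k + 1)` being identified with one another. -/
def columnRel (T : ℕ → ℕ → Prop) : Set (ℕ × ℕ) :=
  {p | p.1 = p.2 ∧ T p.1.unpair.1 p.1.unpair.2 ∨
    T p.1.unpair.1 (p.1.unpair.2 + 1) ∧ T p.2.unpair.1 (p.2.unpair.2 + 1)}

theorem isEqvRel_columnRel (T : ℕ → ℕ → Prop) : IsEqvRel (columnRel T) := by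
  simp only [IsEqvRel, columnRel, Set.mem_ofPred_eq]
  refine ⟨?_, ?_⟩
  · rintro x y (⟨rfl, h⟩ | h) <;> tauto
  · rintro x y z (⟨rfl, h⟩ | h) (⟨rfl, h'⟩ | h') <;> tauto

theorem finiteIndexEqv_columnRel_iff {T : ℕ → ℕ → Prop} (h0 : ∀ u, T u 0)
    (hanti : ∀ u k l, k ≤ l → T u l → T u k) (hmono : ∀ u v k, u ≤ v → T u k → T v k) :
    FiniteIndexEqv (columnRel T) ↔ ∃ u, ∀ k, T u k := by
  constructor
  · rintro ⟨-, hfin⟩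
    by_contra! hu
    have key (u : ℕ) : ∃ k, T u k ∧ ¬ T u (k + 1) := by
      by_contra! h
      obtain ⟨k, hk⟩ := hu u
      exact hk (Nat.rec (h0 u) h k)
    choose k hk hk' using key
    have hclass (u : ℕ) : {y | (Nat.pair u (k u), y) ∈ columnRel T} = {Nat.pair u (k u)} := by
      ext y
      simp [columnRel, hk, hk', eq_comm]
    refine Set.infinite_of_injective_forall_mem
      (f := fun u => ({Nat.pair u (k u)} : Set ℕ)) (fun u v huv => ?_) (fun u => ?_) hfin
    · exact (Nat.pair_eq_pair.1 (Set.singleton_injective huv)).1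
    · exact ⟨Nat.pair u (k u), by simp [columnRel, hk], (hclass u).symm⟩
  · rintro ⟨u, hu⟩
    refine ⟨isEqvRel_columnRel T, ?_⟩
    let F : Set ℕ := {x | T x.unpair.1 x.unpair.2 ∧ ¬ T x.unpair.1 (x.unpair.2 + 1)}
    have hF : F.Finite := by
      refine Set.Finite.of_injOn (f := fun x => x.unpair.1) (t := Set.Iio u) ?_ ?_
        (Set.finite_Iio u)
      · intro x hx
        by_contra hux
        exact hx.2 (hmono _ _ _ (not_lt.1 hux) (hu _))
      · intro x hx y hy hxy
        dsimp only at hxy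
        have hle : x.unpair.2 = y.unpair.2 := by
          rcases lt_trichotomy x.unpair.2 y.unpair.2 with h | h | h
          · exact absurd (hanti _ _ _ h (hxy ▸ hy.1)) hx.2
          · exact h
          · exact absurd (hanti _ _ _ h (hxy ▸ hx.1)) hy.2
        rw [← Nat.pair_unpair x, ← Nat.pair_unpair y, hxy, hle]
    refine ((hF.image singleton).insert {y | T y.unpair.1 (y.unpair.2 + 1)}).subset ?_
    rintro _ ⟨x, hx, rfl⟩
    by_cases hT : T x.unpair.1 (x.unpair.2 + 1)
    · left
      ext y
      simp only [columnRel, Set.mem_ofPred_eq, hT, true_and]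
      exact ⟨by rintro (⟨rfl, -⟩ | h) <;> assumption, Or.inr⟩
    · have hx' : T x.unpair.1 x.unpair.2 := by simpa [columnRel, hT] using hx
      refine Or.inr ⟨x, ⟨hx', hT⟩, ?_⟩
      ext y
      simp [columnRel, hT, hx', eq_comm]

/-- A bounded disjunction commutes with the property that arbitrarily long initial segments
satisfy a predicate. -/
theorem exists_forall_exists_le_iff {R : ℕ → ℕ → Prop} :
    (∃ u, ∀ k, ∃ u' ≤ u, ∀ v < k, R u' v) ↔ ∃ u, ∀ v, R u v := by
  constructor
  · rintro ⟨u, hu⟩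
    by_contra! h
    choose f hf using h
    obtain ⟨u', hu', h⟩ := hu ((Finset.range (u + 1)).sup f + 1)
    exact hf u' (h _ (Nat.lt_succ_of_le
      (Finset.le_sup (f := f) (Finset.mem_range.2 (Nat.lt_succ_of_le hu')))))
  · rintro ⟨u, hu⟩
    exact ⟨u, fun _ => ⟨u, le_rfl, fun v _ => hu v⟩⟩

theorem forall_lt_exists_iff_exists_list {R : ℕ → ℕ → Prop} {k : ℕ} :
    (∀ v < k, ∃ w, R v w) ↔ ∃ l : List ℕ, ∀ v < k, R v (l.getD v 0) := by
  constructor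
  · intro h
    choose! f hf using h
    exact ⟨(List.range k).map f, fun v hv => by simpa [hv] using hf v hv⟩
  · exact fun ⟨l, hl⟩ v hv => ⟨_, hl v hv⟩

end EquivalenceRelations

section Main

variable {A : Set ℕ}

/-- The matrix of a `Σ₃` form of finite index for a relation whose pairs `(x, y)` are those
for which `D (⟨x, y⟩, t)` holds for some `t`: the entries of `q.1` are an index `e` and a bound for
representatives, and those of `q.2` are the universally and the existentially quantified tuple. -/
def indexMatrix (D : ℕ × ℕ × ℕ → Prop)
    (q : (ℕ × ℕ) × (ℕ × ℕ × ℕ × ℕ × ℕ) × (ℕ × ℕ × ℕ × ℕ × ℕ)) : Prop :=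
  (D (q.1.1, Nat.pair q.2.1.1 q.2.1.2.1, q.2.1.2.2.2.1) →
    D (q.1.1, Nat.pair q.2.1.1 q.2.1.1, q.2.2.2.1) ∧
      D (q.1.1, Nat.pair q.2.1.2.1 q.2.1.1, q.2.2.2.2.1)) ∧
  (D (q.1.1, Nat.pair q.2.1.1 q.2.1.2.1, q.2.1.2.2.2.1) ∧
    D (q.1.1, Nat.pair q.2.1.2.1 q.2.1.2.2.1, q.2.1.2.2.2.2) →
      D (q.1.1, Nat.pair q.2.1.1 q.2.1.2.2.1, q.2.2.2.2.2.1)) ∧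
  (D (q.1.1, Nat.pair q.2.1.1 q.2.1.1, q.2.1.2.2.2.1) →
    q.2.2.1 < q.1.2 ∧ D (q.1.1, Nat.pair q.2.1.1 q.2.2.1, q.2.2.2.2.2.2))

theorem recPred_indexMatrix {D : ℕ × ℕ × ℕ → Prop} (hD : RecPred A D) :
    RecPred A (indexMatrix D) := by
  have hD' {f g h k : (ℕ × ℕ) × (ℕ × ℕ × ℕ × ℕ × ℕ) × (ℕ × ℕ × ℕ × ℕ × ℕ) → ℕ}
      (hf : Primrec f) (hg : Primrec g) (hh : Primrec h) (hk : Primrec k) :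
      RecPred A fun q => D (f q, Nat.pair (g q) (h q), k q) :=
    hD.comp (TotRec.of_primrec (hf.pair ((Primrec₂.natPair.comp hg hh).pair hk)))
  have he : Primrec fun q : (ℕ × ℕ) × (ℕ × ℕ × ℕ × ℕ × ℕ) × (ℕ × ℕ × ℕ × ℕ × ℕ) => q.1.1 :=
    Primrec.fst.comp .fst
  have hu : Primrec fun q : (ℕ × ℕ) × (ℕ × ℕ × ℕ × ℕ × ℕ) × (ℕ × ℕ × ℕ × ℕ × ℕ) => q.1.2 :=
    Primrec.snd.comp .fst
  have h₁ : Primrec fun q : ℕ × ℕ × ℕ × ℕ × ℕ => q.1 := .fst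
  have h₂ : Primrec fun q : ℕ × ℕ × ℕ × ℕ × ℕ => q.2.1 := Primrec.fst.comp .snd
  have h₃ : Primrec fun q : ℕ × ℕ × ℕ × ℕ × ℕ => q.2.2.1 :=
    Primrec.fst.comp (Primrec.snd.comp .snd)
  have h₄ : Primrec fun q : ℕ × ℕ × ℕ × ℕ × ℕ => q.2.2.2.1 :=
    Primrec.fst.comp (Primrec.snd.comp (Primrec.snd.comp .snd))
  have h₅ : Primrec fun q : ℕ × ℕ × ℕ × ℕ × ℕ => q.2.2.2.2 :=
    Primrec.snd.comp (Primrec.snd.comp (Primrec.snd.comp .snd))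
  have hv : Primrec fun q : (ℕ × ℕ) × (ℕ × ℕ × ℕ × ℕ × ℕ) × (ℕ × ℕ × ℕ × ℕ × ℕ) => q.2.1 :=
    Primrec.fst.comp .snd
  have hw : Primrec fun q : (ℕ × ℕ) × (ℕ × ℕ × ℕ × ℕ × ℕ) × (ℕ × ℕ × ℕ × ℕ × ℕ) => q.2.2 :=
    Primrec.snd.comp .snd
  have hx := h₁.comp hv
  have hy := h₂.comp hv
  have hz := h₃.comp hv
  have ht := h₄.comp hv
  have hs := h₅.comp hv
  have hxy := hD' he hx hy ht
  exact (hxy.imp ((hD' he hx hx (h₂.comp hw)).and (hD' he hy hx (h₃.comp hw)))).and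
    (((hxy.and (hD' he hy hz hs)).imp (hD' he hx hz (h₄.comp hw))).and
      ((hD' he hx hx ht).imp
        ((RecPred.of_rel Primrec.nat_lt (TotRec.of_primrec (h₁.comp hw))
          (TotRec.of_primrec hu)).and (hD' he hx (h₁.comp hw) (h₅.comp hw)))))

theorem finiteIndexEqv_iff_indexMatrix {D : ℕ × ℕ × ℕ → Prop} {E : Set (ℕ × ℕ)} {e : ℕ}
    (hE : ∀ x y, (x, y) ∈ E ↔ ∃ t, D (e, Nat.pair x y, t)) :
    FiniteIndexEqv E ↔ ∃ u, ∀ v, ∃ w, indexMatrix D ((e, u), v, w) := by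
  simp only [finiteIndexEqv_iff, IsEqvRel, hE, indexMatrix]
  constructor
  · rintro ⟨⟨h₁, h₂⟩, N, hN⟩
    refine ⟨N, fun ⟨x, y, z, t, s⟩ => ?_⟩
    have ha : ∃ a b, D (e, Nat.pair x y, t) →
        D (e, Nat.pair x x, a) ∧ D (e, Nat.pair y x, b) := by
      by_cases h : D (e, Nat.pair x y, t)
      · obtain ⟨⟨a, ha⟩, b, hb⟩ := h₁ x y ⟨t, h⟩
        exact ⟨a, b, fun _ => ⟨ha, hb⟩⟩
      · exact ⟨0, 0, fun h' => absurd h' h⟩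
    have hc : ∃ c, D (e, Nat.pair x y, t) ∧ D (e, Nat.pair y z, s) → D (e, Nat.pair x z, c) := by
      by_cases h : D (e, Nat.pair x y, t) ∧ D (e, Nat.pair y z, s)
      · obtain ⟨c, hc⟩ := h₂ x y z ⟨t, h.1⟩ ⟨s, h.2⟩
        exact ⟨c, fun _ => hc⟩
      · exact ⟨0, fun h' => absurd h' h⟩
    have hd : ∃ y' d, D (e, Nat.pair x x, t) → y' < N ∧ D (e, Nat.pair x y', d) := by
      by_cases h : D (e, Nat.pair x x, t)
      · obtain ⟨y', hy', d, hd⟩ := hN x ⟨t, h⟩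
        exact ⟨y', d, fun _ => ⟨hy', hd⟩⟩
      · exact ⟨0, 0, fun h' => absurd h' h⟩
    obtain ⟨a, b, hab⟩ := ha
    obtain ⟨c, hc⟩ := hc
    obtain ⟨y', d, hd⟩ := hd
    exact ⟨(y', a, b, c, d), hab, hc, hd⟩
  · rintro ⟨N, hN⟩
    refine ⟨⟨fun x y ⟨t, ht⟩ => ?_, fun x y z ⟨t, ht⟩ ⟨s, hs⟩ => ?_⟩, N, fun x ⟨t, ht⟩ => ?_⟩
    · obtain ⟨w, h, -, -⟩ := hN (x, y, 0, t, 0)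
      exact ⟨⟨_, (h ht).1⟩, _, (h ht).2⟩
    · obtain ⟨w, -, h, -⟩ := hN (x, y, z, t, s)
      exact ⟨_, h ⟨ht, hs⟩⟩
    · obtain ⟨w, -, -, h⟩ := hN (x, 0, 0, t, 0)
      exact ⟨_, (h ht).1, _, (h ht).2⟩

/-- Being an equivalence relation of finite index is a `Σ₃` property of `A`-indices. -/
theorem exists_recPred_finiteIndexEqv_iff (A : Set ℕ) :
    ∃ R : ℕ × ℕ × ℕ × ℕ → Prop, RecPred A R ∧
      ∀ e, FiniteIndexEqv (W2 A e) ↔ ∃ u, ∀ v, ∃ w, R (e, u, v, w) := by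
  obtain ⟨D, hD, hDom⟩ := exists_recPred_dom_iff A
  have hE (e x y : ℕ) : (x, y) ∈ W2 A e ↔ ∃ t, D (e, Nat.pair x y, t) := by
    obtain ⟨c, rfl⟩ := exists_encOCode_eq e
    rw [mem_W2_encOCode, hDom]
  have hdec : Primrec (Denumerable.ofNat (ℕ × ℕ × ℕ × ℕ × ℕ)) := Primrec.ofNat _
  have hsurj : Function.Surjective (Denumerable.ofNat (ℕ × ℕ × ℕ × ℕ × ℕ)) :=
    fun b => ⟨Encodable.encode b, Denumerable.ofNat_encode b⟩
  refine ⟨fun p => indexMatrix D ((p.1, p.2.1), Denumerable.ofNat _ p.2.2.1,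
      Denumerable.ofNat _ p.2.2.2),
    (recPred_indexMatrix hD).comp
      (TotRec.of_primrec <| (Primrec.fst.pair (Primrec.fst.comp .snd)).pair
        ((hdec.comp (Primrec.fst.comp (Primrec.snd.comp .snd))).pair
          (hdec.comp (Primrec.snd.comp (Primrec.snd.comp .snd))))), fun e => ?_⟩
  rw [finiteIndexEqv_iff_indexMatrix (hE e)]
  exact exists_congr fun u => hsurj.forall.trans (forall_congr' fun v => hsurj.exists)

/-- Every `Σ₃` predicate reduces to being an equivalence relation of finite index. -/
theorem exists_totRec_finiteIndexEqv_iff {α : Type*} [Primcodable α]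
    {R : α × ℕ × ℕ × ℕ → Prop} (hR : RecPred A R) :
    ∃ g : α → ℕ, TotRec A g ∧
      ∀ p, FiniteIndexEqv (W2 A (g p)) ↔ ∃ u, ∀ v, ∃ w, R (p, u, v, w) := by
  let T (p : α) (u k : ℕ) : Prop := ∃ u' ≤ u, ∀ v < k, ∃ w, R (p, u', v, w)
  let Q : (α × ℕ × ℕ) × ℕ × List ℕ → Prop := fun q =>
    q.2.1 ≤ q.1.2.1 ∧ ∀ v < q.1.2.2, R (q.1.1, q.2.1, v, q.2.2.getD v 0)
  have hTQ (p u k) : T p u k ↔ ∃ s, Q ((p, u, k), s) := by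
    simp only [T, Q, Prod.exists, forall_lt_exists_iff_exists_list, exists_and_left]
  have hQ : RecPred A Q := by
    have hR' : RecPred A fun q : ((α × ℕ × ℕ) × ℕ × List ℕ) × ℕ =>
        R (q.1.1.1, q.1.2.1, q.2, q.1.2.2.getD q.2 0) := by
      have h2 : Primrec fun q : ((α × ℕ × ℕ) × ℕ × List ℕ) × ℕ => q.1.2 :=
        Primrec.snd.comp .fst
      exact hR.comp (TotRec.of_primrec
        ((Primrec.fst.comp (Primrec.fst.comp .fst)).pair ((Primrec.fst.comp h2).pair
          (Primrec.snd.pair ((Primrec.list_getD 0).comp (Primrec.snd.comp h2) .snd)))))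
    exact (RecPred.of_rel Primrec.nat_le (TotRec.fst.comp TotRec.snd)
      (TotRec.fst.comp (TotRec.snd.comp TotRec.fst))).and
      (hR'.forall_lt.comp ((TotRec.of_primrec .id).pair
        (TotRec.snd.comp (TotRec.snd.comp TotRec.fst))))
  let S : (α × ℕ × ℕ) × (ℕ × List ℕ) × (ℕ × List ℕ) → Prop := fun q =>
    (q.1.2.1 = q.1.2.2 ∧ Q ((q.1.1, q.1.2.1.unpair), q.2.1)) ∨
    (Q ((q.1.1, q.1.2.1.unpair.1, q.1.2.1.unpair.2 + 1), q.2.1) ∧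
      Q ((q.1.1, q.1.2.2.unpair.1, q.1.2.2.unpair.2 + 1), q.2.2))
  have hS : RecPred A S := by
    have hp : TotRec A fun q : (α × ℕ × ℕ) × (ℕ × List ℕ) × (ℕ × List ℕ) => q.1.1 :=
      TotRec.fst.comp TotRec.fst
    have hx : TotRec A fun q : (α × ℕ × ℕ) × (ℕ × List ℕ) × (ℕ × List ℕ) => q.1.2.1 :=
      TotRec.fst.comp (TotRec.snd.comp TotRec.fst)
    have hy : TotRec A fun q : (α × ℕ × ℕ) × (ℕ × List ℕ) × (ℕ × List ℕ) => q.1.2.2 :=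
      TotRec.snd.comp (TotRec.snd.comp TotRec.fst)
    have hunp : TotRec A Nat.unpair := TotRec.of_primrec Primrec.unpair
    have hnext : TotRec A fun n : ℕ => (n.unpair.1, n.unpair.2 + 1) :=
      (TotRec.fst.comp hunp).pair ((TotRec.of_primrec Primrec.succ).comp (TotRec.snd.comp hunp))
    have hs₁ : TotRec A fun q : (α × ℕ × ℕ) × (ℕ × List ℕ) × (ℕ × List ℕ) => q.2.1 :=
      TotRec.fst.comp TotRec.snd
    have hs₂ : TotRec A fun q : (α × ℕ × ℕ) × (ℕ × List ℕ) × (ℕ × List ℕ) => q.2.2 :=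
      TotRec.snd.comp TotRec.snd
    exact ((RecPred.of_rel Primrec.eq hx hy).and
      (hQ.comp ((hp.pair (hunp.comp hx)).pair hs₁))).or
      ((hQ.comp ((hp.pair (hnext.comp hx)).pair hs₁)).and
        (hQ.comp ((hp.pair (hnext.comp hy)).pair hs₂)))
  obtain ⟨c, hc⟩ := hS.exists_code_dom_iff
  obtain ⟨h, hh, hcurry⟩ := exists_primrec_curry (chi A) c
  refine ⟨fun p => h (Encodable.encode p), TotRec.of_primrec (hh.comp Primrec.encode),
    fun p => ?_⟩
  have hW : W2 A (h (Encodable.encode p)) = columnRel (T p) := by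
    ext ⟨x, y⟩
    obtain ⟨c', hc', hev⟩ := hcurry (Encodable.encode p)
    have := hc (p, x, y)
    simp only [Encodable.encode_prod_val, Encodable.encode_nat] at this
    rw [← hc', mem_W2_encOCode, hev, this]
    simp only [columnRel, Set.mem_ofPred_eq, hTQ, S]
    constructor
    · rintro ⟨⟨s₁, s₂⟩, ⟨h, h₁⟩ | ⟨h₁, h₂⟩⟩
      · exact Or.inl ⟨h, s₁, h₁⟩
      · exact Or.inr ⟨⟨s₁, h₁⟩, s₂, h₂⟩
    · rintro (⟨h, s, h₁⟩ | ⟨⟨s₁, h₁⟩, s₂, h₂⟩)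
      · exact ⟨(s, s), Or.inl ⟨h, h₁⟩⟩
      · exact ⟨(s₁, s₂), Or.inr ⟨h₁, h₂⟩⟩
  rw [hW, finiteIndexEqv_columnRel_iff, exists_forall_exists_le_iff]
  · exact fun u => ⟨u, le_rfl, fun v hv => absurd hv v.not_lt_zero⟩
  · rintro u k l hkl ⟨u', hu', h⟩
    exact ⟨u', hu', fun v hv => h v (hv.trans_le hkl)⟩
  · rintro u v k huv ⟨u', hu', h⟩
    exact ⟨u', hu'.trans huv, h⟩

end Main

theorem stmt13 (A : Set ℕ) (X : Set (List Bool)) :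
    (∃ g : List Bool → ℕ, RecInP A (fun p => Part.some (g p)) ∧
        X = {p | FiniteIndexEqv (W2 A (g p))}) ↔
    (∃ r : List Bool × ℕ × ℕ × ℕ → ℕ, RecInP A (fun z => Part.some (r z)) ∧
        X = {p | ∃ u : ℕ, ∀ v : ℕ, ∃ w : ℕ, r (p, u, v, w) = 1}) := by
  classical
  constructor
  · rintro ⟨g, hg, rfl⟩
    obtain ⟨R, hR, hiff⟩ := exists_recPred_finiteIndexEqv_iff A
    refine ⟨fun z => if R (g z.1, z.2) then 1 else 0,
      hR.comp ((TotRec.comp hg TotRec.fst).pair TotRec.snd), ?_⟩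
    simp [hiff]
  · rintro ⟨r, hr, rfl⟩
    obtain ⟨g, hg, hiff⟩ := exists_totRec_finiteIndexEqv_iff (RecPred.of_eq_const hr 1)
    exact ⟨g, hg, by simp only [hiff]⟩
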